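/- arXiv:1507.07370 — 2 statements merged into one kernel-verified Lean document; each statement's English description precedes it below -/
import Mathlib

section
/- Let p ∈ ℝ[x] be a polynomial with p(0) = 0 of degree d ≥ 1, and let (n_i)_{i=1}^∞ be a sequence of positive integers. Then for every ε > 0 there exists a finite non-empty set α ⊆ ℕ, all of whose gaps are at most d, such that ‖p(∑_{i∈α} n_i)‖_{ℝ/ℤ} ≤ ε. -/
/-- The gaps of a finite set of naturals are all at most `k`: every element which is
not the maximum has a successor in the set within distance `k`. -/
def GapsLE (k : ℕ) (α : Finset ℕ) : Prop :=
  ∀ i ∈ α, ∀ j ∈ α, i < j → ∃ j' ∈ α, i < j' ∧ j' ≤ i + k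

/-- `α ∈ 𝒮_k`: a finite non-empty set all of whose gaps are at most `k`. -/
def InS (k : ℕ) (α : Finset ℕ) : Prop := α.Nonempty ∧ GapsLE k α

open Filter Topology
open scoped commutatorElement

/-- The functions `ℤ → ℝ/ℤ` of polynomial degree less than `m`: those annihilated by any `m`
successive difference operators. -/
def polyLT : ℕ → Submodule ℤ (ℤ → UnitAddCircle)
  | 0 => ⊥
  | m + 1 => ⨅ h : ℤ, (polyLT m).comap (fwdDiff_aux.fwdDiffₗ ℤ UnitAddCircle h)

lemma mem_polyLT_zero {v : ℤ → UnitAddCircle} : v ∈ polyLT 0 ↔ v = 0 :=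
  Submodule.mem_bot ℤ

lemma mem_polyLT_succ {m : ℕ} {v : ℤ → UnitAddCircle} :
    v ∈ polyLT (m + 1) ↔ ∀ h, fwdDiff h v ∈ polyLT m := by
  simp only [polyLT, Submodule.mem_iInf, Submodule.mem_comap]
  rfl

lemma polyLT_mono : Monotone polyLT := by
  refine monotone_nat_of_le_succ fun m => ?_
  induction m with
  | zero => exact bot_le
  | succ m ih =>
    intro v hv
    rw [mem_polyLT_succ] at hv ⊢
    exact fun h => ih (hv h)

lemma shift_mem_polyLT {m : ℕ} {v : ℤ → UnitAddCircle} (hv : v ∈ polyLT m) (a : ℤ) :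
    (fun x => v (x + a)) ∈ polyLT m := by
  induction m generalizing v with
  | zero => rw [mem_polyLT_zero] at hv ⊢; subst hv; rfl
  | succ m ih =>
    rw [mem_polyLT_succ] at hv ⊢
    intro h
    convert ih (hv h) using 1
    ext x
    simp [fwdDiff, add_right_comm]

/-- Polynomial functions of bounded degree are closed under pointwise limits. -/
lemma mem_polyLT_of_tendsto {ι : Type*} {l : Filter ι} [l.NeBot] {m : ℕ}
    {F : ι → ℤ → UnitAddCircle} {g : ℤ → UnitAddCircle} (hF : ∀ i, F i ∈ polyLT m)
    (hg : ∀ x, Tendsto (fun i => F i x) l (𝓝 (g x))) : g ∈ polyLT m := by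
  induction m generalizing F g with
  | zero =>
    rw [mem_polyLT_zero]
    ext x
    refine tendsto_nhds_unique (hg x) ?_
    have : ∀ i, F i x = 0 := fun i => by rw [mem_polyLT_zero.1 (hF i)]; rfl
    simp [this]
  | succ m ih =>
    rw [mem_polyLT_succ]
    intro h
    exact ih (fun i => mem_polyLT_succ.1 (hF i) h) fun x => (hg (x + h)).sub (hg x)

/-- A real polynomial of degree less than `m` induces a polynomial function modulo one. -/
lemma eval_mem_polyLT {m : ℕ} {p : Polynomial ℝ} (hp : p.degree < m) :
    (fun x : ℤ => ((p.eval (x : ℝ) : ℝ) : UnitAddCircle)) ∈ polyLT m := by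
  induction m generalizing p with
  | zero =>
    have hp0 : p = 0 := by
      rw [← Polynomial.degree_eq_bot]
      exact Nat.WithBot.lt_zero_iff.1 (by simpa using hp)
    rw [mem_polyLT_zero]
    ext x
    simp [hp0]
  | succ m ih =>
    rw [mem_polyLT_succ]
    intro h
    have hlt : (Polynomial.taylor (h : ℝ) p - p).degree < m := by
      by_cases hp0 : p = 0
      · simp [hp0]
      · refine (Polynomial.degree_sub_lt_left (Polynomial.degree_taylor p _)
          (by simpa using hp0) (Polynomial.leadingCoeff_taylor _ _)).trans_le ?_
        rw [Polynomial.degree_taylor]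
        rw [Polynomial.degree_eq_natDegree hp0] at hp ⊢
        exact_mod_cast Nat.lt_succ_iff.1 (by exact_mod_cast hp)
    convert ih hlt using 1
    ext x
    simp [fwdDiff, Polynomial.taylor_eval, add_comm]

/-- The limit, along a fixed nonprincipal ultrafilter, of the translates of a function by the terms
of a sequence. -/
noncomputable def limShift (a : ℕ → ℤ) (v : ℤ → UnitAddCircle) (x : ℤ) : UnitAddCircle :=
  ((hyperfilter ℕ).map fun k => v (x + a k)).lim

lemma tendsto_limShift (a : ℕ → ℤ) (v : ℤ → UnitAddCircle) (x : ℤ) :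
    Tendsto (fun k => v (x + a k)) (hyperfilter ℕ) (𝓝 (limShift a v x)) :=
  Ultrafilter.le_nhds_lim _

lemma limShift_eq {a : ℕ → ℤ} {v : ℤ → UnitAddCircle} {x : ℤ} {y : UnitAddCircle}
    (h : Tendsto (fun k => v (x + a k)) (hyperfilter ℕ) (𝓝 y)) : limShift a v x = y :=
  tendsto_nhds_unique (tendsto_limShift a v x) h

lemma limShift_mem_polyLT {m : ℕ} {v : ℤ → UnitAddCircle} (hv : v ∈ polyLT m) (a : ℕ → ℤ) :
    limShift a v ∈ polyLT m :=
  mem_polyLT_of_tendsto (fun k => shift_mem_polyLT hv (a k)) (tendsto_limShift a v)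

/-- The additive operators on polynomial functions of degree less than `D`. -/
abbrev PolyEnd (D : ℕ) : Type := Module.End ℤ (polyLT D)

/-- The operator `limShift a` on polynomial functions of degree less than `D`. -/
noncomputable def shiftOp (D : ℕ) (a : ℕ → ℤ) : PolyEnd D :=
  AddMonoidHom.toIntLinearMap
    { toFun := fun v => ⟨limShift a v, limShift_mem_polyLT v.2 a⟩
      map_zero' := by
        ext x
        exact limShift_eq (by simp)
      map_add' := fun v w => by
        ext x
        exact limShift_eq ((tendsto_limShift a v x).add (tendsto_limShift a w x)) }

/-- The operators which lower the degree of every polynomial function by at least `i`. -/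
def lowering (D i : ℕ) : AddSubgroup (PolyEnd D) where
  carrier := {O | ∀ m (v : polyLT D), (v : ℤ → UnitAddCircle) ∈ polyLT m →
    (O v : ℤ → UnitAddCircle) ∈ polyLT (m - i)}
  zero_mem' := fun _ _ _ => Submodule.zero_mem _
  add_mem' := fun hO hO' m v hv => Submodule.add_mem _ (hO m v hv) (hO' m v hv)
  neg_mem' := fun hO m v hv => Submodule.neg_mem _ (hO m v hv)

lemma one_mem_lowering (D : ℕ) : (1 : PolyEnd D) ∈ lowering D 0 :=
  fun _ _ hv => hv

lemma lowering_antitone (D : ℕ) : Antitone (lowering D) :=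
  fun _ _ hij _ hO m v hv => polyLT_mono (by lia) (hO m v hv)

lemma mul_mem_lowering {D i j : ℕ} {O O' : PolyEnd D}
    (hO : O ∈ lowering D i) (hO' : O' ∈ lowering D j) : O * O' ∈ lowering D (i + j) := by
  intro m v hv
  rw [add_comm i j, Nat.sub_add_eq]
  exact hO _ _ (hO' m v hv)

lemma pow_mem_lowering {D i : ℕ} {O : PolyEnd D} (hO : O ∈ lowering D i) (n : ℕ) :
    O ^ n ∈ lowering D (n * i) := by
  induction n with
  | zero => simpa using one_mem_lowering D
  | succ n ih => rw [pow_succ, Nat.succ_mul]; exact mul_mem_lowering ih hO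

lemma eq_zero_of_mem_lowering {D i : ℕ} (hi : D ≤ i) {O : PolyEnd D}
    (hO : O ∈ lowering D i) : O = 0 := by
  ext1 v
  have := hO D v v.2
  rw [Nat.sub_eq_zero_of_le hi, mem_polyLT_zero] at this
  exact Subtype.ext this

lemma shiftOp_sub_one_mem (D : ℕ) (a : ℕ → ℤ) : shiftOp D a - 1 ∈ lowering D 1 := by
  intro m v hv
  cases m with
  | zero =>
    have : v = 0 := Subtype.ext (mem_polyLT_zero.1 hv)
    rw [this, map_zero]
    exact Submodule.zero_mem _
  | succ m =>
    exact mem_polyLT_of_tendsto (fun k => mem_polyLT_succ.1 hv (a k))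
      fun x => (tendsto_limShift a v x).sub_const _

lemma shiftOp_mul_shiftOp_neg_sub_one_mem (D : ℕ) (a : ℕ → ℤ) :
    shiftOp D a * shiftOp D (-a) - 1 ∈ lowering D 2 := by
  have hsum : shiftOp D a - 1 + (shiftOp D (-a) - 1) ∈ lowering D 2 := by
    intro m v hv
    obtain hm | ⟨m, rfl⟩ : m ≤ 1 ∨ ∃ l, m = l + 1 + 1 := by
      rcases m with _ | _ | m
      · simp
      · simp
      · exact Or.inr ⟨m, rfl⟩
    · have hA := shiftOp_sub_one_mem D a m v hv
      have hB := shiftOp_sub_one_mem D (-a) m v hv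
      rw [Nat.sub_eq_zero_of_le hm] at hA hB
      rw [Nat.sub_eq_zero_of_le (by lia : m ≤ 2)]
      exact Submodule.add_mem _ hA hB
    · refine mem_polyLT_of_tendsto (l := (hyperfilter ℕ : Filter ℕ))
        (F := fun k x => fwdDiff (a k) (fwdDiff (a k) (v : ℤ → UnitAddCircle)) (x + -a k))
        (fun k => shift_mem_polyLT (mem_polyLT_succ.1 (mem_polyLT_succ.1 hv _) _) _) fun x => ?_
      refine (((tendsto_limShift a v x).sub_const (v.1 x)).add
        ((tendsto_limShift (-a) v x).sub_const (v.1 x))).congr fun k => ?_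
      simp only [fwdDiff, Pi.neg_apply, neg_add_cancel_right]
      abel
  have : shiftOp D a * shiftOp D (-a) - 1 =
      (shiftOp D a - 1) * (shiftOp D (-a) - 1) + (shiftOp D a - 1 + (shiftOp D (-a) - 1)) := by
    noncomm_ring
  rw [this]
  exact add_mem (mul_mem_lowering (shiftOp_sub_one_mem D a) (shiftOp_sub_one_mem D (-a))) hsum

/-- The group of invertible operators `u` such that `u - 1` lowers degrees by at least one. -/
def unipotent (D : ℕ) : Subgroup (PolyEnd D)ˣ where
  carrier := {u | (u : PolyEnd D) - 1 ∈ lowering D 1}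
  one_mem' := by simp [zero_mem]
  mul_mem' := by
    intro u w hu hw
    have : (↑(u * w) : PolyEnd D) - 1 =
        ((u : PolyEnd D) - 1) * ((w : PolyEnd D) - 1) +
          (((u : PolyEnd D) - 1) + ((w : PolyEnd D) - 1)) := by
      push_cast; noncomm_ring
    rw [Set.mem_ofPred_eq, this]
    exact add_mem (lowering_antitone D (by norm_num) (mul_mem_lowering hu hw)) (add_mem hu hw)
  inv_mem' := by
    intro u hu
    set a : PolyEnd D := 1 - u with ha
    have ha1 : a ∈ lowering D 1 := by rw [ha, ← neg_sub]; exact neg_mem hu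
    have hgeom : (↑u⁻¹ : PolyEnd D) = ∑ i ∈ Finset.range D, a ^ i := by
      rw [Units.inv_eq_of_mul_eq_one_right]
      have hu' : (u : PolyEnd D) = 1 - a := by rw [ha]; abel
      rw [hu', mul_neg_geom_sum,
        eq_zero_of_mem_lowering (by lia) (pow_mem_lowering ha1 D), sub_zero]
    have hsum : (↑u⁻¹ : PolyEnd D) ∈ lowering D 0 := by
      rw [hgeom]
      exact sum_mem fun i _ => lowering_antitone D (Nat.zero_le _) (pow_mem_lowering ha1 i)
    have : (↑u⁻¹ : PolyEnd D) - 1 = ↑u⁻¹ * a := by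
      rw [ha, mul_sub, mul_one, Units.inv_mul]
    rw [Set.mem_ofPred_eq, this]
    simpa using mul_mem_lowering hsum ha1

lemma mem_unipotent {D : ℕ} {u : (PolyEnd D)ˣ} :
    u ∈ unipotent D ↔ (u : PolyEnd D) - 1 ∈ lowering D 1 := Iff.rfl

lemma mem_lowering_of_mem_unipotent {D : ℕ} {u : (PolyEnd D)ˣ}
    (hu : u ∈ unipotent D) : (u : PolyEnd D) ∈ lowering D 0 := by
  simpa using add_mem (lowering_antitone D zero_le_one hu) (one_mem_lowering D)

lemma commutator_sub_one_mem_lowering {D i : ℕ} {u w : (PolyEnd D)ˣ}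
    (hu : u ∈ unipotent D) (hw : w ∈ unipotent D)
    (hwi : (w : PolyEnd D) - 1 ∈ lowering D i) :
    (↑⁅u, w⁆ : PolyEnd D) - 1 ∈ lowering D (i + 1) := by
  have key : (↑⁅u, w⁆ : PolyEnd D) - 1 =
      (((u : PolyEnd D) - 1) * ((w : PolyEnd D) - 1) -
        ((w : PolyEnd D) - 1) * ((u : PolyEnd D) - 1)) *
        ↑(u⁻¹ * w⁻¹) := by
    have h : (w : PolyEnd D) * u * ↑(u⁻¹ * w⁻¹) = 1 := by
      rw [← Units.val_mul, ← Units.val_mul]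
      simp
    have h' : (↑⁅u, w⁆ : PolyEnd D) = u * w * ↑(u⁻¹ * w⁻¹) := by
      rw [commutatorElement_def, ← Units.val_mul, ← Units.val_mul]
      simp [mul_assoc]
    calc (↑⁅u, w⁆ : PolyEnd D) - 1
        = (u : PolyEnd D) * w * ↑(u⁻¹ * w⁻¹) - (w : PolyEnd D) * u * ↑(u⁻¹ * w⁻¹) := by rw [h', h]
      _ = _ := by noncomm_ring
  rw [key]
  refine mul_mem_lowering (j := 0) (sub_mem ?_ (mul_mem_lowering hwi hu))
    (mem_lowering_of_mem_unipotent (mul_mem (inv_mem hu) (inv_mem hw)))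
  rw [add_comm i 1]
  exact mul_mem_lowering hu hwi

/-- The operator `shiftOp D a` as an invertible operator. -/
noncomputable def shiftUnit (D : ℕ) (a : ℕ → ℤ) : (PolyEnd D)ˣ :=
  (show IsUnit (shiftOp D a) by
    have : IsNilpotent (shiftOp D a - 1) :=
      ⟨D, eq_zero_of_mem_lowering (by lia) (pow_mem_lowering (shiftOp_sub_one_mem D a) D)⟩
    simpa using this.isUnit_one_add).unit

lemma shiftUnit_mem_unipotent (D : ℕ) (a : ℕ → ℤ) : shiftUnit D a ∈ unipotent D :=
  shiftOp_sub_one_mem D a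

attribute [local instance] Ultrafilter.addSemigroup

/-- Along an idempotent ultrafilter, the powers of a unipotent operator tend to the identity. -/
lemma tendsto_pow_of_idempotent {D : ℕ} {u : (PolyEnd D)ˣ} (hu : u ∈ unipotent D)
    {U : Ultrafilter ℕ+} (hU : U + U = U) {m : ℕ} (w : polyLT D)
    (hw : (w : ℤ → UnitAddCircle) ∈ polyLT m) (x : ℤ) :
    Tendsto (fun n : ℕ+ => (((u ^ (n : ℕ) : (PolyEnd D)ˣ) : PolyEnd D) w
      : ℤ → UnitAddCircle) x) U (𝓝 ((w : ℤ → UnitAddCircle) x)) := by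
  induction m generalizing w with
  | zero =>
    have : w = 0 := Subtype.ext (mem_polyLT_zero.1 hw)
    simp [this]
  | succ m ih =>
    set f : ℕ+ → UnitAddCircle := fun n =>
      (((u ^ (n : ℕ) : (PolyEnd D)ˣ) : PolyEnd D) w
        : ℤ → UnitAddCircle) x with hf
    set y := (U.map f).lim
    have hy : Tendsto f U (𝓝 y) := Ultrafilter.le_nhds_lim (U.map f)
    suffices y + (y - (w : ℤ → UnitAddCircle) x) = y by
      have hyw : y = (w : ℤ → UnitAddCircle) x := by simpa [sub_eq_zero] using this
      rwa [hyw] at hy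
    by_contra hne
    obtain ⟨C, ⟨hC, hCcl⟩, hCsub⟩ :=
      (closed_nhds_basis y).mem_iff.1 (isOpen_compl_singleton.mem_nhds (Ne.symm hne))
    have hlim : ∀ n : ℕ+, Tendsto (fun n' => f (n + n')) U
        (𝓝 (y + (f n - (w : ℤ → UnitAddCircle) x))) := by
      intro n
      have hlow := mem_unipotent.1 (pow_mem hu (n : ℕ)) (m + 1) w hw
      refine (hy.add (ih _ hlow)).congr fun n' => ?_
      simp only [hf, PNat.add_coe, add_comm (n : ℕ), pow_add, Units.val_mul, Module.End.mul_apply,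
        LinearMap.sub_apply, Module.End.one_apply, map_sub, Submodule.coe_sub, Pi.sub_apply]
      abel
    have hmem : ∀ᶠ n in U, ∀ᶠ n' in U, f (n + n') ∈ C := by
      refine (Ultrafilter.eventually_add U U fun n => f n ∈ C).1 ?_
      rw [hU]
      exact hy hC
    have hmem' : ∀ᶠ n in U, y + (f n - (w : ℤ → UnitAddCircle) x) ∈ C :=
      hmem.mono fun n hn => hCcl.mem_of_tendsto (hlim n) hn
    have := hCcl.mem_of_tendsto ((hy.sub_const _).const_add y) hmem'
    exact hCsub this (by simp)

/-- Unipotent operators are recurrent. -/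
lemma exists_pow_norm_lt {D : ℕ} {u : (PolyEnd D)ˣ} (hu : u ∈ unipotent D)
    (w : polyLT D) (x : ℤ) {ε : ℝ} (hw : ‖(w : ℤ → UnitAddCircle) x‖ < ε) :
    ∃ n : ℕ, ‖(((u ^ (n + 1) : (PolyEnd D)ˣ) : PolyEnd D) w
      : ℤ → UnitAddCircle) x‖ < ε := by
  obtain ⟨U, hU⟩ := exists_idempotent_of_compact_t2_of_continuous_add_left
    (@Ultrafilter.continuous_add_left ℕ+ _)
  obtain ⟨n, hn⟩ := ((tendsto_pow_of_idempotent hu hU w w.2 x).norm.eventually_lt_const hw).exists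
  exact ⟨n.natPred, by rwa [PNat.natPred_add_one]⟩

/-- The partial sums of `n` along the residue class of `c` modulo `d`. -/
def trackSum (d : ℕ) (n : ℕ → ℕ) (c k : ℕ) : ℤ :=
  ∑ j ∈ Finset.range k, (n (d * j + c) : ℤ)

/-- `α` is an initial segment, up to `d * k`, of a set under construction to which, from now on, the
elements of the residue classes in `S` are being added. The number `x` is the sum of `n` over `α`,
reduced by the full partial sums along the classes in `S`. -/
structure IsPartial (d : ℕ) (n : ℕ → ℕ) (S : Finset ℕ) (k : ℕ) (x : ℤ) (α : Finset ℕ) : Prop where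
  lt : ∀ i ∈ α, i < d * k
  gap : ∀ i ∈ α, (∃ j ∈ α, i < j ∧ j ≤ i + d) ∨ ∃ c ∈ S, d * k + c ≤ i + d
  sum : ∑ i ∈ α, (n i : ℤ) = x + ∑ c ∈ S, trackSum d n c k

lemma isPartial_empty (d : ℕ) (n : ℕ → ℕ) : IsPartial d n ∅ 0 0 ∅ := by
  constructor <;> simp

section IsPartial

variable {d : ℕ} {n : ℕ → ℕ} {S : Finset ℕ} {k : ℕ} {x : ℤ} {α : Finset ℕ}

lemma IsPartial.succ (h : IsPartial d n S k x α) (hS : S ⊆ Finset.range d) :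
    IsPartial d n S (k + 1) x (α ∪ S.image (d * k + ·)) where
  lt i hi := by
    rw [Finset.mem_union, Finset.mem_image] at hi
    obtain hi | ⟨c, hc, rfl⟩ := hi
    · exact (h.lt i hi).trans_le (Nat.mul_le_mul_left d k.le_succ)
    · have := Finset.mem_range.1 (hS hc)
      rw [Nat.mul_succ]
      lia
  gap i hi := by
    rw [Finset.mem_union, Finset.mem_image] at hi
    obtain hi | ⟨c, hc, rfl⟩ := hi
    · left
      obtain ⟨j, hj, hij⟩ | ⟨c, hc, hle⟩ := h.gap i hi
      · exact ⟨j, Finset.mem_union_left _ hj, hij⟩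
      · have := h.lt i hi
        exact ⟨d * k + c, Finset.mem_union_right _ (Finset.mem_image_of_mem _ hc), by lia, hle⟩
    · exact Or.inr ⟨c, hc, by rw [Nat.mul_succ]; lia⟩
  sum := by
    rw [Finset.sum_union, h.sum, Finset.sum_image (by intro; simp), add_assoc,
      ← Finset.sum_add_distrib]
    · simp only [trackSum, Finset.sum_range_succ]
    · rw [Finset.disjoint_left]
      intro i hi hi'
      obtain ⟨c, -, rfl⟩ := Finset.mem_image.1 hi'
      have := h.lt _ hi
      lia

lemma IsPartial.extend (h : IsPartial d n S k x α) (hS : S ⊆ Finset.range d) {l : ℕ} (hl : k ≤ l) :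
    ∃ β, IsPartial d n S (l + 1) x β ∧ ∀ c ∈ S, d * l + c ∈ β := by
  have hex : ∃ β, IsPartial d n S l x β := by
    induction l, hl using Nat.le_induction with
    | base => exact ⟨α, h⟩
    | succ l _ ih => exact ih.elim fun β hβ => ⟨_, hβ.succ hS⟩
  obtain ⟨β, hβ⟩ := hex
  exact ⟨_, hβ.succ hS, fun c hc => Finset.mem_union_right _ (Finset.mem_image_of_mem _ hc)⟩

lemma IsPartial.insert (h : IsPartial d n S k x α) {c : ℕ} (hc : c ∉ S) :
    IsPartial d n (insert c S) k (x - trackSum d n c k) α where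
  lt := h.lt
  gap i hi := (h.gap i hi).imp_right fun ⟨b, hb, hle⟩ => ⟨b, Finset.mem_insert_of_mem hb, hle⟩
  sum := by rw [h.sum, Finset.sum_insert hc]; ring

lemma IsPartial.erase (h : IsPartial d n S (k + 1) x α) (hS : S ⊆ Finset.range d)
    (hα : ∀ b ∈ S, d * k + b ∈ α) {c : ℕ} (hc : c ∈ S) (hne : (S.erase c).Nonempty) :
    IsPartial d n (S.erase c) (k + 1) (x + trackSum d n c (k + 1)) α where
  lt := h.lt
  gap i hi := by
    obtain hi | ⟨b, hb, hle⟩ := h.gap i hi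
    · exact Or.inl hi
    obtain ⟨b', hb'⟩ := hne
    have hb'S := Finset.mem_of_mem_erase hb'
    have hb'd := Finset.mem_range.1 (hS hb'S)
    rw [Nat.mul_succ] at hle ⊢
    by_cases hlt : i < d * k + b'
    · exact Or.inl ⟨_, hα b' hb'S, hlt, by lia⟩
    · exact Or.inr ⟨b', hb', by lia⟩
  sum := by rw [h.sum, ← Finset.add_sum_erase S _ hc]; ring

lemma IsPartial.gapsLE (h : IsPartial d n S k x α) : GapsLE d α := by
  intro i hi j hj hij
  obtain hi | ⟨c, -, hle⟩ := h.gap i hi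
  · exact hi
  · have := h.lt j hj
    exact ⟨j, hj, hij, by lia⟩

end IsPartial

/-- If `u v` is small at a partial construction in the state `S`, then the construction can be
continued to the state `S'` so that `v` is as small there. -/
def Steers (d : ℕ) (n : ℕ → ℕ) {D : ℕ} (S S' : Finset ℕ) (u : (PolyEnd D)ˣ) : Prop :=
  ∀ (v : polyLT D) (x : ℤ) (k : ℕ) (α : Finset ℕ) (ε : ℝ), IsPartial d n S k x α →
    ‖((u : PolyEnd D) v : ℤ → UnitAddCircle) x‖ < ε →
    ∃ k' x' α', IsPartial d n S' k' x' α' ∧ ‖(v : ℤ → UnitAddCircle) x'‖ < ε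

lemma exists_norm_lt_of_limShift {a : ℕ → ℤ} {v : ℤ → UnitAddCircle} {x : ℤ} {ε : ℝ}
    (h : ‖limShift a v x‖ < ε) (k : ℕ) : ∃ l, k ≤ l ∧ ‖v (x + a (l + 1))‖ < ε := by
  obtain ⟨l, hl, hkl⟩ := (((tendsto_limShift a v x).norm.eventually_lt_const h).and
    (Nat.hyperfilter_le_atTop (eventually_ge_atTop (k + 1)))).exists
  obtain ⟨l, rfl⟩ := Nat.exists_eq_add_of_le hkl
  exact ⟨k + l, by lia, by rwa [add_right_comm]⟩

section Steers

variable {d : ℕ} {n : ℕ → ℕ} {D : ℕ} {S S' S'' : Finset ℕ} {u w : (PolyEnd D)ˣ} {c : ℕ}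

lemma Steers.mul (hu : Steers d n S S' u) (hw : Steers d n S' S'' w) :
    Steers d n S S'' (u * w) := by
  intro v x k α ε hα hv
  obtain ⟨k', x', α', hα', hv'⟩ := hu ((w : PolyEnd D) v) x k α ε hα hv
  exact hw v x' k' α' ε hα' hv'

lemma Steers.pow (hu : Steers d n S S u) (m : ℕ) : Steers d n S S (u ^ m) := by
  induction m with
  | zero => exact fun v x k α ε hα hv => ⟨k, x, α, hα, hv⟩
  | succ m ih => rw [pow_succ]; exact ih.mul hu

lemma Steers.inv (hu : Steers d n S S u) (hu1 : u ∈ unipotent D) : Steers d n S S u⁻¹ := by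
  intro v x k α ε hα hv
  obtain ⟨m, hm⟩ := exists_pow_norm_lt hu1 _ x hv
  rw [← Module.End.mul_apply, ← Units.val_mul, pow_succ, mul_inv_cancel_right] at hm
  exact hu.pow m v x k α ε hα hm

lemma steers_off (hS : S ⊆ Finset.range d) (hc : c ∈ S) (hne : (S.erase c).Nonempty) :
    Steers d n S (S.erase c) (shiftUnit D (trackSum d n c)) := by
  intro v x k α ε hα hv
  obtain ⟨l, hkl, hl⟩ := exists_norm_lt_of_limShift hv k
  obtain ⟨β, hβ, hβS⟩ := hα.extend hS hkl
  exact ⟨_, _, β, hβ.erase hS hβS hc hne, hl⟩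

lemma steers_on (hS : S ⊆ Finset.range d) (hc : c ∉ S) :
    Steers d n S (insert c S) (shiftUnit D (-trackSum d n c)) := by
  intro v x k α ε hα hv
  obtain ⟨l, hkl, hl⟩ := exists_norm_lt_of_limShift hv k
  obtain ⟨β, hβ, -⟩ := hα.extend hS hkl
  exact ⟨_, _, β, hβ.insert hc, hl⟩

lemma steers_off_on (hS : S ⊆ Finset.range d) (hc : c ∈ S) (hne : (S.erase c).Nonempty) :
    Steers d n S S (shiftUnit D (trackSum d n c) * shiftUnit D (-trackSum d n c)) := by
  have := steers_on (D := D) (n := n) ((Finset.erase_subset c S).trans hS) (S.notMem_erase c)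
  rw [Finset.insert_erase hc] at this
  exact (steers_off hS hc hne).mul this

end Steers

/-- The iterated commutator `[A_j, [A_{j-1}, …, [A_1, A_0 B_0]]]`, where `A_c` switches the residue
class `c` off and `B_c` switches it on. -/
noncomputable def iterComm (d : ℕ) (n : ℕ → ℕ) (D : ℕ) : ℕ → (PolyEnd D)ˣ
  | 0 => shiftUnit D (trackSum d n 0) * shiftUnit D (-trackSum d n 0)
  | j + 1 => ⁅shiftUnit D (trackSum d n (j + 1)), iterComm d n D j⁆

/-- The product `A_j ⋯ A_1 A_0`, switching the residue classes up to `j` off. -/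
noncomputable def switchOff (d : ℕ) (n : ℕ → ℕ) (D : ℕ) : ℕ → (PolyEnd D)ˣ
  | 0 => shiftUnit D (trackSum d n 0)
  | j + 1 => shiftUnit D (trackSum d n (j + 1)) * switchOff d n D j

section IterComm

variable {d : ℕ} {n : ℕ → ℕ} {D : ℕ}

lemma iterComm_mem_unipotent (j : ℕ) : iterComm d n D j ∈ unipotent D := by
  induction j with
  | zero => exact mul_mem (shiftUnit_mem_unipotent _ _) (shiftUnit_mem_unipotent _ _)
  | succ j ih =>
    have hA := shiftUnit_mem_unipotent D (trackSum d n (j + 1))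
    exact mul_mem (mul_mem (mul_mem hA ih) (inv_mem hA)) (inv_mem ih)

lemma iterComm_sub_one_mem_lowering (j : ℕ) :
    (iterComm d n D j : PolyEnd D) - 1 ∈ lowering D (j + 2) := by
  induction j with
  | zero => exact shiftOp_mul_shiftOp_neg_sub_one_mem D _
  | succ j ih =>
    exact commutator_sub_one_mem_lowering (shiftUnit_mem_unipotent _ _)
      (iterComm_mem_unipotent j) ih

lemma iterComm_eq_one {j : ℕ} (hj : D ≤ j + 2) : iterComm d n D j = 1 :=
  Units.ext (sub_eq_zero.1 (eq_zero_of_mem_lowering hj (iterComm_sub_one_mem_lowering j)))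

lemma iterComm_succ (j : ℕ) : iterComm d n D (j + 1) =
    shiftUnit D (trackSum d n (j + 1)) * iterComm d n D j * shiftUnit D (-trackSum d n (j + 1)) *
      (shiftUnit D (trackSum d n (j + 1)) * shiftUnit D (-trackSum d n (j + 1)))⁻¹ *
      (iterComm d n D j)⁻¹ := by
  rw [iterComm, commutatorElement_def]
  group

lemma steers_iterComm {j : ℕ} {S : Finset ℕ} (hS : S ⊆ Finset.range d)
    (hjS : Finset.range (j + 1) ⊆ S) (hne : (S \ Finset.range (j + 1)).Nonempty) :
    Steers d n S S (iterComm d n D j) := by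
  induction j generalizing S with
  | zero =>
    refine steers_off_on hS (hjS (by simp)) (hne.mono fun i hi => ?_)
    simp only [Finset.mem_sdiff, Finset.mem_range, Finset.mem_erase] at hi ⊢
    exact ⟨by lia, hi.1⟩
  | succ j ih =>
    have hmem : j + 1 ∈ S := hjS (by simp)
    obtain ⟨i, hi⟩ := hne
    simp only [Finset.mem_sdiff, Finset.mem_range] at hi
    have hE : S.erase (j + 1) ⊆ Finset.range d := (Finset.erase_subset _ S).trans hS
    have hiE : i ∈ S.erase (j + 1) := Finset.mem_erase.2 ⟨by lia, hi.1⟩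
    have hsub : Finset.range (j + 1) ⊆ S.erase (j + 1) := fun b hb => by
      have := Finset.mem_range.1 hb
      exact Finset.mem_erase.2 ⟨by lia, hjS (Finset.mem_range.2 (by lia))⟩
    have hloop := steers_off_on (n := n) (D := D) hS hmem ⟨i, hiE⟩
    have hon := steers_on (n := n) (D := D) hE (S.notMem_erase (j + 1))
    rw [Finset.insert_erase hmem] at hon
    have hinner := ih hE hsub ⟨i, Finset.mem_sdiff.2 ⟨hiE, by simp; lia⟩⟩
    have houter := ih hS (hsub.trans (Finset.erase_subset _ S))
      ⟨i, Finset.mem_sdiff.2 ⟨hi.1, by simp; lia⟩⟩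
    rw [iterComm_succ]
    exact ((((steers_off hS hmem ⟨i, hiE⟩).mul hinner).mul hon).mul (hloop.inv
      (mul_mem (shiftUnit_mem_unipotent _ _) (shiftUnit_mem_unipotent _ _)))).mul
      (houter.inv (iterComm_mem_unipotent j))

/-- Starting from the empty set, all residue classes up to `j` can be switched on in such a way that
the resulting operator is `(A_j ⋯ A_0)⁻¹ [A_j, [A_{j-1}, …, [A_1, A_0 B_0]]]`. -/
lemma steers_switchOff_inv_mul_iterComm {j : ℕ} (hj : j < d) :
    Steers d n ∅ (Finset.range (j + 1)) ((switchOff d n D j)⁻¹ * iterComm d n D j) := by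
  induction j with
  | zero =>
    rw [switchOff, iterComm, inv_mul_cancel_left]
    exact steers_on (Finset.empty_subset _) (Finset.notMem_empty 0)
  | succ j ih =>
    have hS : Finset.range (j + 1 + 1) ⊆ Finset.range d := Finset.range_subset_range.2 hj
    have hon := steers_on (d := d) (n := n) (D := D) (S := Finset.range (j + 1)) (c := j + 1)
      (Finset.range_subset_range.2 (by lia)) (by simp)
    rw [← Finset.range_add_one] at hon
    have hloop := steers_off_on (n := n) (D := D) (c := j + 1) hS (by simp) ⟨0, by simp⟩
    have hsub : Finset.range (j + 1) ⊆ Finset.range (j + 1 + 1) :=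
      Finset.range_subset_range.2 (by lia)
    have hcomm := steers_iterComm (n := n) (D := D) (j := j) hS hsub ⟨j + 1, by simp⟩
    have heq : (switchOff d n D (j + 1))⁻¹ * iterComm d n D (j + 1) =
        (switchOff d n D j)⁻¹ * iterComm d n D j * shiftUnit D (-trackSum d n (j + 1)) *
          (shiftUnit D (trackSum d n (j + 1)) * shiftUnit D (-trackSum d n (j + 1)))⁻¹ *
          (iterComm d n D j)⁻¹ := by
      rw [iterComm_succ, switchOff]
      group
    rw [heq]
    exact (((ih (by lia)).mul hon).mul (hloop.inv
      (mul_mem (shiftUnit_mem_unipotent _ _) (shiftUnit_mem_unipotent _ _)))).mul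
      (hcomm.inv (iterComm_mem_unipotent j))

lemma exists_gapsLE_of_switchOff {j : ℕ} (hj : j < d) (v : polyLT D) {x : ℤ} {k : ℕ}
    {α : Finset ℕ} {ε : ℝ} (hα : IsPartial d n (Finset.range (j + 1)) k x α)
    (hv : ‖((switchOff d n D j : PolyEnd D) v : ℤ → UnitAddCircle) x‖ < ε) :
    ∃ β : Finset ℕ, β.Nonempty ∧ GapsLE d β ∧
      ‖(v : ℤ → UnitAddCircle) (∑ i ∈ β, (n i : ℤ))‖ < ε := by
  have hS : Finset.range (j + 1) ⊆ Finset.range d := Finset.range_subset_range.2 hj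
  induction j generalizing x k α with
  | zero =>
    obtain ⟨l, hkl, hl⟩ := exists_norm_lt_of_limShift hv k
    obtain ⟨β, hβ, hβS⟩ := hα.extend hS hkl
    refine ⟨β, ⟨_, hβS 0 (by simp)⟩, hβ.gapsLE, ?_⟩
    rw [hβ.sum]
    simpa using hl
  | succ j ih =>
    have hoff := steers_off (n := n) (D := D) (c := j + 1) hS (by simp) ⟨0, by simp⟩
    rw [Finset.range_add_one, Finset.erase_insert (by simp)] at hoff
    rw [Finset.range_add_one] at hα
    obtain ⟨k', x', α', hα', hv'⟩ := hoff _ x k α ε hα hv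
    exact ih (by lia) hα' hv' (Finset.range_subset_range.2 (by lia))

end IterComm

/-- If `p ∈ ℝ[x]` has `p(0) = 0` and degree `d ≥ 1`, and `(n_i)` is a
sequence of positive integers, then for every `ε > 0` there is a finite non-empty set
`α` with gaps bounded by `d` such that `p(∑_{i ∈ α} n_i)` is within `ε` of an integer
(distance measured in `ℝ/ℤ`). -/
theorem statement0 (d : ℕ) (hd : 1 ≤ d) (p : Polynomial ℝ)
    (hp0 : p.eval 0 = 0) (hdeg : p.natDegree = d)
    (n : ℕ → ℕ) (hn : ∀ i, 0 < n i) (ε : ℝ) (hε : 0 < ε) :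
    ∃ α : Finset ℕ, α.Nonempty ∧ GapsLE d α ∧
      ‖((p.eval ((∑ i ∈ α, n i : ℕ) : ℝ) : ℝ) : AddCircle (1 : ℝ))‖ ≤ ε := by
  obtain ⟨j, rfl⟩ := Nat.exists_eq_add_of_le' hd
  have hdeg' : p.degree < ((j + 2 : ℕ) : WithBot ℕ) :=
    Polynomial.degree_le_natDegree.trans_lt (by rw [hdeg]; exact_mod_cast Nat.lt_succ_self (j + 1))
  let v : polyLT (j + 2) := ⟨_, eval_mem_polyLT hdeg'⟩
  have hsteer := steers_switchOff_inv_mul_iterComm (n := n) (D := j + 2) (Nat.lt_succ_self j)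
  rw [iterComm_eq_one le_rfl, mul_one] at hsteer
  obtain ⟨k, x, α, hα, hv⟩ := hsteer ((switchOff (j + 1) n (j + 2) j : PolyEnd (j + 2)) v) 0 0 ∅ ε
    (isPartial_empty _ n) (by
      rw [← Module.End.mul_apply, Units.inv_mul, Module.End.one_apply]
      simpa [v, hp0] using hε)
  obtain ⟨β, hne, hgap, hβ⟩ := exists_gapsLE_of_switchOff (Nat.lt_succ_self j) v hα hv
  refine ⟨β, hne, hgap, le_of_lt ?_⟩
  simpa [v] using hβ
end

section
/- Let f : 𝓕∅ → 𝕋^m be a polynomial of degree ≤ 2 with f(∅) = 0. Then for every ε > 0 there exists α ∈ 𝒮_2 (a finite non-empty subset of ℕ all of whose gaps are at most 2) such that ‖f(α)‖ < ε, where ‖·‖ denotes the distance to 0 in 𝕋^m. -/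
/-- Polynomial maps of degree ≤ `d` from `𝓕∅` to an abelian group, defined recursively:
degree ≤ 0 means constant, and degree ≤ d+1 means all discrete derivatives
`Δ_β f (α) = f (α ∪ β) - f α` (for `β` non-empty, `α` disjoint from `β`)
agree with some polynomial of degree ≤ d. -/
def PolyDeg {M : Type*} [AddCommGroup M] : ℕ → (Finset ℕ → M) → Prop
  | 0, f => ∀ α β : Finset ℕ, f α = f β
  | d + 1, f => ∀ β : Finset ℕ, β.Nonempty → ∃ g : Finset ℕ → M, PolyDeg d g ∧
      ∀ α : Finset ℕ, Disjoint α β → g α = f (α ∪ β) - f α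

open Filter Topology

section Limits

variable {M : Type*} [NormedAddCommGroup M]

/-- The limit of a sequence in a compact group along a fixed nonprincipal ultrafilter. -/
noncomputable def ulim (g : ℕ → M) : M := limUnder (hyperfilter ℕ : Filter ℕ) g

lemma tendsto_ulim [CompactSpace M] (g : ℕ → M) : Tendsto g (hyperfilter ℕ : Filter ℕ) (𝓝 (ulim g)) :=
  ((hyperfilter ℕ).map g).le_nhds_lim

lemma ulim_eq_of_tendsto {g : ℕ → M} {x : M}
    (h : Tendsto g (hyperfilter ℕ : Filter ℕ) (𝓝 x)) : ulim g = x :=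
  h.limUnder_eq

lemma ulim_add [CompactSpace M] (g h : ℕ → M) : ulim (fun n => g n + h n) = ulim g + ulim h :=
  ulim_eq_of_tendsto ((tendsto_ulim g).add (tendsto_ulim h))

lemma ulim_const (x : M) : ulim (fun _ => x) = x :=
  ulim_eq_of_tendsto tendsto_const_nhds

lemma eventually_gt_hyperfilter (s : ℕ) : ∀ᶠ t in (hyperfilter ℕ : Filter ℕ), s < t :=
  (Nat.hyperfilter_le_atTop) (eventually_gt_atTop s)

lemma ulim_congr_of_gt [CompactSpace M] {g h : ℕ → M} (s : ℕ) (hgh : ∀ t, s < t → g t = h t) :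
    ulim g = ulim h :=
  ulim_eq_of_tendsto ((tendsto_ulim h).congr'
    ((eventually_gt_hyperfilter s).mono fun t ht => (hgh t ht).symm))

end Limits

/-- The second difference `f (α ∪ β) - f α - f β`. -/
def cross {M : Type*} [AddCommGroup M] (f : Finset ℕ → M) (α β : Finset ℕ) : M :=
  f (α ∪ β) - f α - f β

/-- `f` is quadratic: `cross f` is additive on disjoint sets. -/
def CrossAdditive {M : Type*} [AddCommGroup M] (f : Finset ℕ → M) : Prop :=
  ∀ α β γ : Finset ℕ, Disjoint α β → Disjoint α γ → Disjoint β γ →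
    cross f (α ∪ β) γ = cross f α γ + cross f β γ

lemma PolyDeg.crossAdditive {M : Type*} [AddCommGroup M] {f : Finset ℕ → M}
    (hf : PolyDeg 2 f) (hf0 : f ∅ = 0) : CrossAdditive f := by
  intro α β γ hαβ hαγ hβγ
  rcases β.eq_empty_or_nonempty with rfl | hβ
  · simp [cross, hf0]
  rcases γ.eq_empty_or_nonempty with rfl | hγ
  · simp [cross, hf0]
  obtain ⟨g, hg, hgf⟩ := hf γ hγ
  obtain ⟨h, hh, hhg⟩ := hg β hβ
  have h1 := hhg α hαβ
  have h2 := hhg ∅ (Finset.disjoint_empty_left _)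
  rw [hh α ∅, h2, hgf _ (Finset.disjoint_union_left.2 ⟨hαγ, hβγ⟩), hgf _ hαγ,
    hgf _ (by simpa using hβγ), hgf _ (Finset.disjoint_empty_left _)] at h1
  simp only [Finset.empty_union, hf0] at h1
  simp only [cross]
  rw [eq_comm, ← sub_eq_zero] at h1 ⊢
  rw [← neg_eq_zero, ← h1]
  abel

lemma cross_comm {M : Type*} [AddCommGroup M] (f : Finset ℕ → M) (α β : Finset ℕ) :
    cross f α β = cross f β α := by
  simp only [cross, Finset.union_comm α β]; abel

lemma CrossAdditive.right {M : Type*} [AddCommGroup M] {f : Finset ℕ → M}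
    (hf : CrossAdditive f) {α β γ : Finset ℕ} (hαβ : Disjoint α β) (hαγ : Disjoint α γ)
    (hβγ : Disjoint β γ) : cross f α (β ∪ γ) = cross f α β + cross f α γ := by
  rw [cross_comm, hf β γ α hβγ hαβ.symm hαγ.symm, cross_comm, cross_comm f γ]

/-- The three ways of filling a block: even numbers, odd numbers, everything. -/
inductive Filling
  | evens
  | odds
  | full

namespace Filling

/-- The elements of `[2s, 2t)` selected by a filling. -/
def cell : Filling → ℕ → ℕ → Finset ℕ
  | evens, s, t => (Finset.Ico (2 * s) (2 * t)).filter (· % 2 = 0)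
  | odds, s, t => (Finset.Ico (2 * s) (2 * t)).filter (· % 2 = 1)
  | full, s, t => Finset.Ico (2 * s) (2 * t)

/-- The first element of `X.cell s t` is `2 * s + X.startOffset`. -/
def startOffset : Filling → ℕ
  | evens => 0
  | odds => 1
  | full => 0

/-- The last element of `X.cell s t` is `2 * t - X.endOffset`. -/
def endOffset : Filling → ℕ
  | evens => 2
  | odds => 1
  | full => 1

lemma mem_Ico_of_mem_cell {X : Filling} {s t i : ℕ} (h : i ∈ X.cell s t) :
    2 * s + X.startOffset ≤ i ∧ i + X.endOffset ≤ 2 * t := by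
  cases X <;> simp [cell, startOffset, endOffset] at h ⊢ <;> omega

lemma start_mem_cell (X : Filling) {s t : ℕ} (h : s < t) :
    2 * s + X.startOffset ∈ X.cell s t := by
  cases X <;> simp [cell, startOffset] <;> omega

lemma end_mem_cell (X : Filling) {s t : ℕ} (h : s < t) :
    2 * t - X.endOffset ∈ X.cell s t := by
  cases X <;> simp [cell, endOffset] <;> omega

lemma gapsLE_cell (X : Filling) (s t : ℕ) : GapsLE 2 (X.cell s t) := by
  intro i hi j hj hij
  cases X
  · refine ⟨i + 2, ?_, by omega, by omega⟩
    simp [cell] at hi hj ⊢; omega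
  · refine ⟨i + 2, ?_, by omega, by omega⟩
    simp [cell] at hi hj ⊢; omega
  · refine ⟨i + 1, ?_, by omega, by omega⟩
    simp [cell] at hi hj ⊢; omega

lemma cell_union (X : Filling) {s t u : ℕ} (hst : s < t) (htu : t < u) :
    X.cell s u = X.cell s t ∪ X.cell t u := by
  ext i; cases X <;> simp [cell] <;> omega

lemma disjoint_cell (X Y : Filling) (s t u : ℕ) : Disjoint (X.cell s t) (Y.cell t u) := by
  rw [Finset.disjoint_left]
  intro i hi hj
  have h1 := (mem_Ico_of_mem_cell hi).2
  have h2 := (mem_Ico_of_mem_cell hj).1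
  cases X <;> simp only [endOffset] at h1 <;> omega

lemma disjoint_evens_odds (s t : ℕ) : Disjoint (evens.cell s t) (odds.cell s t) := by
  rw [Finset.disjoint_left]
  intro i hi hj
  simp [cell] at hi hj; omega

lemma full_cell (s t : ℕ) : full.cell s t = evens.cell s t ∪ odds.cell s t := by
  ext i; simp [cell]; omega

end Filling

open Filling

/-- `α` is a set with gaps at most `2`, all of whose elements lie below `2 * t` and whose last
element is that of a block of type `X` ending at `2 * t`. -/
structure EndsAt (α : Finset ℕ) (X : Filling) (t : ℕ) : Prop where
  gaps : GapsLE 2 α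
  le_last : ∀ i ∈ α, i + X.endOffset ≤ 2 * t
  last_mem : 2 * t - X.endOffset ∈ α

lemma EndsAt.disjoint_cell {α : Finset ℕ} {X : Filling} {s : ℕ} (h : EndsAt α X s)
    (Y : Filling) {t u : ℕ} (hst : s ≤ t) : Disjoint α (Y.cell t u) := by
  rw [Finset.disjoint_left]
  intro i hi hj
  have h1 := h.le_last i hi
  have h2 := (mem_Ico_of_mem_cell hj).1
  cases X <;> simp only [endOffset] at h1 <;> omega

lemma endsAt_cell (X : Filling) {s t : ℕ} (hst : s < t) : EndsAt (X.cell s t) X t :=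
  ⟨X.gapsLE_cell s t, fun _ hi => (mem_Ico_of_mem_cell hi).2, X.end_mem_cell hst⟩

lemma EndsAt.union_cell {α : Finset ℕ} {X : Filling} {s : ℕ} (h : EndsAt α X s) {Y : Filling}
    (hXY : X.endOffset + Y.startOffset ≤ 2) {t : ℕ} (hst : s < t) :
    EndsAt (α ∪ Y.cell s t) Y t := by
  have hpos : 0 < X.endOffset := by cases X <;> simp [endOffset]
  have hY : Y.endOffset ≤ 2 := by cases Y <;> simp [endOffset]
  refine ⟨?_, ?_, Finset.mem_union_right _ (Y.end_mem_cell hst)⟩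
  · intro i hi j hj hij
    rw [Finset.mem_union] at hi hj
    rcases hi with hi | hi
    · by_cases hlast : i < 2 * s - X.endOffset
      · obtain ⟨k, hk, h1⟩ := h.gaps i hi _ h.last_mem hlast
        exact ⟨k, Finset.mem_union_left _ hk, h1⟩
      · have := h.le_last i hi
        exact ⟨_, Finset.mem_union_right _ (Y.start_mem_cell hst), by omega, by omega⟩
    · rcases hj with hj | hj
      · have h1 := h.le_last j hj
        have h2 := (mem_Ico_of_mem_cell hi).1
        omega
      · obtain ⟨k, hk, h1⟩ := Y.gapsLE_cell s t i hi j hj hij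
        exact ⟨k, Finset.mem_union_right _ hk, h1⟩
  · intro i hi
    rcases Finset.mem_union.1 hi with hi | hi
    · have := h.le_last i hi
      omega
    · exact (mem_Ico_of_mem_cell hi).2

section Quadratic

variable {M : Type*} [NormedAddCommGroup M] [CompactSpace M] (f : Finset ℕ → M)

/-- The limiting interaction of `α` with a long block of type `Y` starting at `2 * t`. -/
noncomputable def tailCross (Y : Filling) (α : Finset ℕ) (t : ℕ) : M :=
  ulim fun u => cross f α (Y.cell t u)

/-- The limiting value of `f` on a block of type `X`. -/
noncomputable def blockValue (X : Filling) : M :=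
  ulim fun s => ulim fun t => f (X.cell s t)

/-- The limiting interaction of consecutive blocks of types `X` and `Y`. -/
noncomputable def bond (X Y : Filling) : M :=
  ulim fun s => ulim fun t => tailCross f Y (X.cell s t) t

variable {f}

lemma blockValue_eq_neg_bond (X : Filling) : blockValue f X = -bond f X X := by
  have key : blockValue f X = blockValue f X + blockValue f X + bond f X X := by
    have h : ∀ s, ulim (fun u => f (X.cell s u)) =
        ulim (fun t => f (X.cell s t)) + blockValue f X
          + ulim (fun t => tailCross f X (X.cell s t) t) := by
      intro s
      rw [blockValue, ← ulim_add, ← ulim_add, ← ulim_const (ulim fun u => f (X.cell s u))]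
      refine ulim_congr_of_gt s fun t hst => ?_
      rw [tailCross, ← ulim_const (f (X.cell s t)), ← ulim_add, ← ulim_add]
      refine ulim_congr_of_gt t fun u htu => ?_
      rw [cross, ← X.cell_union hst htu]
      abel
    have h' := congrArg ulim (funext h)
    rwa [ulim_add, ulim_add, ulim_const] at h'
  rw [eq_neg_iff_add_eq_zero]
  have h := sub_eq_zero.2 key
  rw [← neg_eq_zero, ← h]
  abel

lemma bond_full_left (hf : CrossAdditive f) (Y : Filling) :
    bond f full Y = bond f evens Y + bond f odds Y := by
  simp only [bond, tailCross, ← ulim_add]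
  congr! with s t u
  rw [full_cell, hf _ _ _ (disjoint_evens_odds s t) (disjoint_cell _ _ _ _ _)
    (disjoint_cell _ _ _ _ _)]

lemma bond_full_right (hf : CrossAdditive f) (X : Filling) :
    bond f X full = bond f X evens + bond f X odds := by
  simp only [bond, tailCross, ← ulim_add]
  congr! with s t u
  rw [full_cell, hf.right (disjoint_cell _ _ _ _ _) (disjoint_cell _ _ _ _ _)
    (disjoint_evens_odds t u)]

variable (f) in
/-- `v` is a limit value of `f` on concatenations of long blocks, the last one of type `X`. -/
def Reachable (v : M) (X : Filling) : Prop :=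
  ∀ δ > 0, ∀ᶠ t in (hyperfilter ℕ : Filter ℕ), ∃ α, EndsAt α X t ∧ ‖f α - v‖ < δ ∧
    ∀ Y, ‖tailCross f Y α t - bond f X Y‖ < δ

lemma eventually_norm_ulim_sub_lt (g : ℕ → M) {δ : ℝ} (hδ : 0 < δ) :
    ∀ᶠ t in (hyperfilter ℕ : Filter ℕ), ‖g t - ulim g‖ < δ := by
  simpa [dist_eq_norm] using (tendsto_ulim g).eventually (Metric.ball_mem_nhds _ hδ)

lemma eventually_forall_filling {l : Filter ℕ} {P : Filling → ℕ → Prop}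
    (h : ∀ Y, ∀ᶠ t in l, P Y t) : ∀ᶠ t in l, ∀ Y, P Y t := by
  filter_upwards [h evens, h odds, h full] with t h1 h2 h3 Y
  cases Y <;> assumption

lemma reachable_blockValue (X : Filling) : Reachable f (blockValue f X) X := by
  intro δ hδ
  obtain ⟨s, hs1, hs2⟩ := ((eventually_norm_ulim_sub_lt
    (fun s => ulim fun t => f (X.cell s t)) (half_pos hδ)).and
    (eventually_forall_filling fun Y => eventually_norm_ulim_sub_lt
      (fun s => ulim fun t => tailCross f Y (X.cell s t) t) (half_pos hδ))).exists
  filter_upwards [eventually_norm_ulim_sub_lt (fun t => f (X.cell s t)) (half_pos hδ),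
    eventually_forall_filling fun Y => eventually_norm_ulim_sub_lt
      (fun t => tailCross f Y (X.cell s t) t) (half_pos hδ),
    eventually_gt_hyperfilter s] with t h1 h2 hst
  refine ⟨X.cell s t, endsAt_cell X hst, ?_, fun Y => ?_⟩
  · have := norm_sub_le_norm_sub_add_norm_sub (f (X.cell s t)) (ulim fun t => f (X.cell s t))
      (blockValue f X)
    rw [blockValue] at this ⊢
    linarith
  · have := norm_sub_le_norm_sub_add_norm_sub (tailCross f Y (X.cell s t) t)
      (ulim fun t => tailCross f Y (X.cell s t) t) (bond f X Y)
    have h3 := h2 Y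
    have h4 := hs2 Y
    rw [bond] at this ⊢
    linarith

lemma EndsAt.ulim_tailCross_union (hf : CrossAdditive f) {α : Finset ℕ} {X : Filling} {s : ℕ}
    (h : EndsAt α X s) (Z Y : Filling) :
    ulim (fun t => tailCross f Y (α ∪ Z.cell s t) t) =
      ulim fun t => tailCross f Y (Z.cell s t) t := by
  have key : ulim (fun t => tailCross f Y (α ∪ Z.cell s t) t + cross f α (Y.cell s t)) =
      ulim fun t => tailCross f Y (Z.cell s t) t + tailCross f Y α s := by
    refine ulim_congr_of_gt s fun t hst => ?_
    rw [tailCross, tailCross, tailCross, ← ulim_const (cross f α (Y.cell s t)), ← ulim_add,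
      ← ulim_add]
    refine ulim_congr_of_gt t fun u htu => ?_
    rw [hf _ _ _ (h.disjoint_cell _ le_rfl) (h.disjoint_cell _ hst.le)
      (Filling.disjoint_cell _ _ _ _ _), Y.cell_union hst htu, hf.right (h.disjoint_cell _ le_rfl)
      (h.disjoint_cell _ hst.le) (Filling.disjoint_cell _ _ _ _ _)]
    abel
  rw [ulim_add, ulim_add, ulim_const] at key
  exact add_right_cancel key

lemma Reachable.append (hf : CrossAdditive f) {v : M} {X : Filling} (h : Reachable f v X)
    (Z : Filling) (hXZ : X.endOffset + Z.startOffset ≤ 2) :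
    Reachable f (v + blockValue f Z + bond f X Z) Z := by
  intro δ hδ
  have hδ4 : 0 < δ / 4 := by positivity
  obtain ⟨s, ⟨α, hα, hv, hαY⟩, hs1, hs2⟩ := ((h (δ / 4) hδ4).and
    ((eventually_norm_ulim_sub_lt (fun s => ulim fun t => f (Z.cell s t)) hδ4).and
    (eventually_forall_filling fun Y => eventually_norm_ulim_sub_lt
      (fun s => ulim fun t => tailCross f Y (Z.cell s t) t) hδ4))).exists
  filter_upwards [eventually_norm_ulim_sub_lt
      (fun t => f (Z.cell s t) + cross f α (Z.cell s t)) hδ4,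
    eventually_forall_filling fun Y => eventually_norm_ulim_sub_lt
      (fun t => tailCross f Y (α ∪ Z.cell s t) t) hδ4,
    eventually_gt_hyperfilter s] with t h1 h2 hst
  refine ⟨α ∪ Z.cell s t, hα.union_cell hXZ hst, ?_, fun Y => ?_⟩
  · rw [ulim_add] at h1
    have h3 := hαY Z
    change ‖_ - blockValue f Z‖ < _ at hs1
    change ‖_ - (_ + tailCross f Z α s)‖ < _ at h1
    have hsplit : f (α ∪ Z.cell s t) - (v + blockValue f Z + bond f X Z) =
        (f α - v) + (f (Z.cell s t) + cross f α (Z.cell s t) -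
          ((ulim fun t => f (Z.cell s t)) + tailCross f Z α s)) +
        ((ulim fun t => f (Z.cell s t)) - blockValue f Z) +
        (tailCross f Z α s - bond f X Z) := by
      rw [cross]; abel
    rw [hsplit]
    refine lt_of_le_of_lt (norm_add₄_le ..) ?_
    linarith
  · have h3 := h2 Y
    have h4 := hs2 Y
    rw [hα.ulim_tailCross_union hf] at h3
    have := norm_sub_le_norm_sub_add_norm_sub (tailCross f Y (α ∪ Z.cell s t) t)
      (ulim fun t => tailCross f Y (Z.cell s t) t) (bond f Z Y)
    rw [bond] at this ⊢
    linarith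

lemma Reachable.append_odds_full (hf : CrossAdditive f) {v : M} (h : Reachable f v full) :
    Reachable f (v - bond f evens evens) full := by
  have := (h.append hf odds (by decide)).append hf full (by decide)
  simp only [blockValue_eq_neg_bond, bond_full_left hf, bond_full_right hf] at this
  convert this using 1
  abel

lemma Reachable.append_evens_full (hf : CrossAdditive f) {v : M} (h : Reachable f v full) :
    Reachable f (v - bond f odds odds) full := by
  have := (h.append hf evens (by decide)).append hf full (by decide)
  simp only [blockValue_eq_neg_bond, bond_full_left hf, bond_full_right hf] at this
  convert this using 1
  abel

lemma reachable_neg_nsmul (hf : CrossAdditive f) (n : ℕ) :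
    Reachable f (-((n + 2) • (bond f evens evens + bond f odds odds))) evens := by
  have hstart : Reachable f (-(2 • (bond f evens evens + bond f odds odds)) -
      bond f odds evens) full := by
    have := (((reachable_blockValue (f := f) full).append hf odds (by decide)).append hf evens
      (by decide)).append hf full (by decide)
    simp only [blockValue_eq_neg_bond, bond_full_left hf, bond_full_right hf] at this
    convert this using 1
    abel
  have hloop : Reachable f (-((n + 2) • (bond f evens evens + bond f odds odds)) -
      bond f odds evens) full := by
    induction n with
    | zero => simpa using hstart
    | succ n ih =>
      convert (ih.append_odds_full hf).append_evens_full hf using 1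
      rw [show n + 1 + 2 = (n + 2) + 1 from rfl, succ_nsmul]
      abel
  have := hloop.append hf evens (by decide)
  simp only [blockValue_eq_neg_bond, bond_full_left hf] at this
  convert this using 1
  abel

lemma exists_norm_nsmul_lt (x : M) {ε : ℝ} (hε : 0 < ε) : ∃ n : ℕ, ‖(n + 2) • x‖ < ε := by
  have h := (mapClusterPt_zero_atTop_nsmul x).frequently (Metric.ball_mem_nhds 0 hε)
  obtain ⟨k, hk, hk2⟩ := (h.and_eventually (eventually_ge_atTop 2)).exists
  obtain ⟨n, rfl⟩ := Nat.exists_eq_add_of_le' hk2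
  exact ⟨n, by simpa using hk⟩

end Quadratic

/-- If `f : 𝓕∅ → 𝕋^m` is a polynomial of degree ≤ 2 with `f ∅ = 0`,
then for every `ε > 0` there is `α ∈ 𝒮_2` with `‖f α‖ < ε`. -/
theorem statement14 (m : ℕ) (f : Finset ℕ → (Fin m → AddCircle (1 : ℝ)))
    (hf : PolyDeg 2 f) (hf0 : f ∅ = 0) (ε : ℝ) (hε : 0 < ε) :
    ∃ α : Finset ℕ, InS 2 α ∧ ‖f α‖ < ε := by
  have hq := hf.crossAdditive hf0
  obtain ⟨n, hn⟩ := exists_norm_nsmul_lt (bond f evens evens + bond f odds odds) (half_pos hε)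
  obtain ⟨t, α, hα, hv, -⟩ := (reachable_neg_nsmul hq n (ε / 2) (half_pos hε)).exists
  refine ⟨α, ⟨⟨_, hα.last_mem⟩, hα.gaps⟩, ?_⟩
  have h := norm_add_le (f α - -((n + 2) • (bond f evens evens + bond f odds odds)))
    (-((n + 2) • (bond f evens evens + bond f odds odds)))
  rw [sub_add_cancel, norm_neg] at h
  linarith
end
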